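/- Let α ∈ (0,1), T > 0, let a₁, a₂ : [0,T] → ℝ be continuous with a₁(t) ≤ a₂(t) for all t ∈ [0,T], and let x₀ ∈ ℝ. If x₁, x₂ : [0,T] → ℝ are continuous and satisfy x_i(t) = x₀ + (1/Γ(α)) ∫₀^t (t−s)^{α−1} a_i(s) x_i(s) ds for every t ∈ [0,T] (i = 1,2), then |x₁(t)| ≤ |x₂(t)| for all t ∈ [0,T]. -/

import Mathlib

open MeasureTheory Set

open ProbabilityTheory in
theorem integrable_betaPDFReal {p q : ℝ} (hp : 0 < p) (hq : 0 < q) :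
    Integrable (betaPDFReal p q) := by
  refine ⟨(stronglyMeasurable_betaPDFReal p q).aestronglyMeasurable, ?_⟩
  rw [hasFiniteIntegral_iff_ofReal]
  · change ∫⁻ x, betaPDF p q x < ⊤
    rw [lintegral_betaPDF_eq_one hp hq]
    exact ENNReal.one_lt_top
  · refine Filter.Eventually.of_forall fun x => ?_
    by_cases h : 0 < x ∧ x < 1
    · exact (betaPDFReal_pos h.1 h.2 hp hq).le
    · simp [betaPDFReal, h]

open ProbabilityTheory in
theorem setIntegral_betaPDFReal {p q : ℝ} (hp : 0 < p) (hq : 0 < q) :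
    ∫ x in Ioo 0 1, betaPDFReal p q x = 1 := by
  rw [setIntegral_eq_integral_of_forall_compl_eq_zero, integral_eq_lintegral_of_nonneg_ae]
  · change (∫⁻ x, betaPDF p q x).toReal = 1
    simp [lintegral_betaPDF_eq_one hp hq]
  · refine Filter.Eventually.of_forall fun x => ?_
    by_cases h : 0 < x ∧ x < 1
    · exact (betaPDFReal_pos h.1 h.2 hp hq).le
    · simp [betaPDFReal, h]
  · exact (stronglyMeasurable_betaPDFReal p q).aestronglyMeasurable
  · intro x hx
    exact if_neg hx

/-- The Poisson-type kernel that represents a Riemann–Liouville potential of a density supported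
in `(-∞, ξ)`, evaluated at `t > ξ`, as an average of its values on `(-∞, ξ)`. -/
noncomputable def balayageKernel (α ξ t τ : ℝ) : ℝ :=
  (1 / ProbabilityTheory.beta α (1 - α)) * ((t - ξ) ^ α * (ξ - τ) ^ (-α) / (t - τ))

theorem balayageKernel_nonneg {α ξ t τ : ℝ} (hα : α ∈ Ioo (0 : ℝ) 1) (hξt : ξ < t) (hτ : τ < ξ) :
    0 ≤ balayageKernel α ξ t τ := by
  have := ProbabilityTheory.beta_pos hα.1 (sub_pos.2 hα.2)
  have h1 : 0 < t - ξ := by linarith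
  have h2 : 0 < ξ - τ := by linarith
  have h3 : 0 < t - τ := by linarith
  unfold balayageKernel
  positivity

theorem measurable_balayageKernel (α ξ t : ℝ) : Measurable (balayageKernel α ξ t) := by
  unfold balayageKernel
  fun_prop

/-- The Möbius substitution mapping `(s, ξ)` onto `(0, 1)` in the beta integral. -/
noncomputable def moebiusSubst (s ξ t τ : ℝ) : ℝ := (t - ξ) * (τ - s) / ((ξ - s) * (t - τ))

theorem moebiusSubst_image {s ξ t : ℝ} (hs : s < ξ) (ht : ξ < t) :
    moebiusSubst s ξ t '' Ioo s ξ = Ioo 0 1 := by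
  ext y
  constructor
  · rintro ⟨τ, ⟨h1, h2⟩, rfl⟩
    have h3 : 0 < (ξ - s) * (t - τ) := mul_pos (by linarith) (by linarith)
    refine ⟨div_pos (mul_pos (by linarith) (by linarith)) h3, ?_⟩
    rw [moebiusSubst, div_lt_one h3]
    nlinarith [mul_pos (sub_pos.2 (hs.trans ht)) (sub_pos.2 h2)]
  · rintro ⟨h0, h1⟩
    have hL : 0 < ξ - s := by linarith
    have hh : 0 < t - ξ := by linarith
    have hD : 0 < (t - ξ) + y * (ξ - s) := by positivity
    have e1 : (y * (ξ - s) * t + (t - ξ) * s) / ((t - ξ) + y * (ξ - s)) - s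
        = y * (ξ - s) * (t - s) / ((t - ξ) + y * (ξ - s)) := by field_simp; ring
    have e2 : ξ - (y * (ξ - s) * t + (t - ξ) * s) / ((t - ξ) + y * (ξ - s))
        = (1 - y) * (ξ - s) * (t - ξ) / ((t - ξ) + y * (ξ - s)) := by field_simp; ring
    have e3 : t - (y * (ξ - s) * t + (t - ξ) * s) / ((t - ξ) + y * (ξ - s))
        = (t - ξ) * (t - s) / ((t - ξ) + y * (ξ - s)) := by field_simp; ring
    have hts : 0 < t - s := by linarith
    have hy1 : 0 < 1 - y := by linarith
    refine ⟨(y * (ξ - s) * t + (t - ξ) * s) / ((t - ξ) + y * (ξ - s)), ⟨?_, ?_⟩, ?_⟩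
    · rw [← sub_pos, e1]; positivity
    · rw [← sub_pos, e2]; positivity
    · rw [moebiusSubst, e1, e3]
      field_simp

theorem injOn_moebiusSubst {s ξ t : ℝ} (hs : s < ξ) (ht : ξ < t) :
    InjOn (moebiusSubst s ξ t) (Ioo s ξ) := by
  rintro x ⟨-, hx⟩ y ⟨-, hy⟩ h
  have hL : 0 < ξ - s := by linarith
  have hh : 0 < t - ξ := by linarith
  have hx' : 0 < t - x := by linarith
  have hy' : 0 < t - y := by linarith
  have hts : 0 < t - s := by linarith
  rw [moebiusSubst, moebiusSubst, div_eq_div_iff (by positivity) (by positivity)] at h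
  have : (t - ξ) * (ξ - s) * (t - s) * (x - y) = 0 := by linear_combination h
  have := (mul_eq_zero.1 this).resolve_left (by positivity)
  linarith

theorem hasDerivAt_moebiusSubst {s ξ t τ : ℝ} (hs : s < ξ) (ht : τ < t) :
    HasDerivAt (moebiusSubst s ξ t) ((t - ξ) * (t - s) / ((ξ - s) * (t - τ) ^ 2)) τ := by
  have hL : ξ - s ≠ 0 := by linarith
  have hτ : t - τ ≠ 0 := by linarith
  have h1 : HasDerivAt (fun τ => (t - ξ) * (τ - s)) ((t - ξ) * 1) τ :=
    ((hasDerivAt_id τ).sub_const s).const_mul _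
  have h2 : HasDerivAt (fun τ => (ξ - s) * (t - τ)) ((ξ - s) * -1) τ :=
    ((hasDerivAt_id τ).const_sub t).const_mul _
  refine (h1.div h2 (mul_ne_zero hL hτ)).congr_deriv ?_
  field_simp
  ring

theorem abs_deriv_smul_betaPDFReal_moebiusSubst {α s ξ t τ : ℝ}
    (hτ : τ ∈ Ioo s ξ) (ht : ξ < t) :
    |(t - ξ) * (t - s) / ((ξ - s) * (t - τ) ^ 2)| •
        ProbabilityTheory.betaPDFReal α (1 - α) (moebiusSubst s ξ t τ) =
      (t - s) ^ (1 - α) * (balayageKernel α ξ t τ * (τ - s) ^ (α - 1)) := by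
  have hmem : moebiusSubst s ξ t τ ∈ Ioo (0 : ℝ) 1 :=
    moebiusSubst_image (hτ.1.trans hτ.2) ht ▸ mem_image_of_mem _ hτ
  have hL : 0 < ξ - s := by linarith [hτ.1, hτ.2]
  have hh : 0 < t - ξ := by linarith
  have h1 : 0 < τ - s := by linarith [hτ.1]
  have h2 : 0 < ξ - τ := by linarith [hτ.2]
  have h3 : 0 < t - τ := by linarith
  have h4 : 0 < t - s := by linarith
  have e : 1 - moebiusSubst s ξ t τ = (t - s) * (ξ - τ) / ((ξ - s) * (t - τ)) := by
    rw [moebiusSubst]; field_simp; ring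
  rw [ProbabilityTheory.betaPDFReal, if_pos ⟨hmem.1, hmem.2⟩, e, moebiusSubst, balayageKernel,
    abs_of_pos (by positivity), smul_eq_mul, show 1 - α - 1 = -α by ring,
    Real.div_rpow (by positivity) (by positivity), Real.div_rpow (by positivity) (by positivity),
    Real.mul_rpow hh.le h1.le, Real.mul_rpow hL.le h3.le, Real.mul_rpow h4.le h2.le,
    Real.mul_rpow hL.le h3.le, Real.rpow_sub_one hh.ne', Real.rpow_sub_one hL.ne',
    Real.rpow_sub_one h3.ne', Real.rpow_sub h4, Real.rpow_one, Real.rpow_neg hL.le,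
    Real.rpow_neg h3.le, Real.rpow_neg h4.le]
  have p1 := Real.rpow_pos_of_pos hL α
  have p2 := Real.rpow_pos_of_pos h3 α
  have p3 := Real.rpow_pos_of_pos h4 α
  field_simp

theorem integrableOn_balayageKernel_mul_rpow {α s ξ t : ℝ} (hα : α ∈ Ioo (0 : ℝ) 1)
    (hs : s < ξ) (ht : ξ < t) :
    IntegrableOn (fun τ => balayageKernel α ξ t τ * (τ - s) ^ (α - 1)) (Ioo s ξ) := by
  have h := (integrableOn_image_iff_integrableOn_abs_deriv_smul measurableSet_Ioo
    (fun τ hτ => (hasDerivAt_moebiusSubst hs (hτ.2.trans ht)).hasDerivWithinAt)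
    (injOn_moebiusSubst hs ht) (ProbabilityTheory.betaPDFReal α (1 - α))).1
    (integrable_betaPDFReal hα.1 (sub_pos.2 hα.2)).integrableOn
  rw [integrableOn_congr_fun (fun τ hτ => abs_deriv_smul_betaPDFReal_moebiusSubst hτ ht)
    measurableSet_Ioo] at h
  have hpos : (t - s) ^ (1 - α) ≠ 0 := (Real.rpow_pos_of_pos (by linarith) _).ne'
  simpa [hpos, mul_assoc, IntegrableOn] using h.const_mul ((t - s) ^ (1 - α))⁻¹

theorem setIntegral_balayageKernel_mul_rpow {α s ξ t : ℝ} (hα : α ∈ Ioo (0 : ℝ) 1)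
    (hs : s < ξ) (ht : ξ < t) :
    ∫ τ in Ioo s ξ, balayageKernel α ξ t τ * (τ - s) ^ (α - 1) = (t - s) ^ (α - 1) := by
  have h := integral_image_eq_integral_abs_deriv_smul measurableSet_Ioo
    (fun τ hτ => (hasDerivAt_moebiusSubst hs (hτ.2.trans ht)).hasDerivWithinAt)
    (injOn_moebiusSubst hs ht) (ProbabilityTheory.betaPDFReal α (1 - α))
  rw [moebiusSubst_image hs ht, setIntegral_betaPDFReal hα.1 (sub_pos.2 hα.2),
    setIntegral_congr_fun measurableSet_Ioo
      (fun τ hτ => abs_deriv_smul_betaPDFReal_moebiusSubst hτ ht), integral_const_mul] at h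
  have hpos : 0 < t - s := by linarith
  rw [show α - 1 = -(1 - α) by ring, Real.rpow_neg hpos.le]
  rw [← neg_sub 1 α] at h
  exact eq_inv_of_mul_eq_one_right h.symm

theorem intervalIntegrable_sub_rpow {α t : ℝ} (hα : 0 < α) (a b : ℝ) :
    IntervalIntegrable (fun s => (t - s) ^ (α - 1)) volume a b := by
  have h := (intervalIntegral.intervalIntegrable_rpow' (a := t - a) (b := t - b)
    (r := α - 1) (by linarith)).comp_sub_left t
  simpa using h

/-- The integrand of the double integral behind the balayage identity. -/
theorem integrable_balayage_prod {α ξ t : ℝ} (hα : α ∈ Ioo (0 : ℝ) 1) (hξt : ξ < t)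
    {w : ℝ → ℝ} (hw : ContinuousOn w (Icc 0 ξ)) :
    Integrable (Function.uncurry fun s τ => w s * (Ioi s).indicator
        (fun τ => balayageKernel α ξ t τ * (τ - s) ^ (α - 1)) τ)
      ((volume.restrict (Ioo 0 ξ)).prod (volume.restrict (Ioo 0 ξ))) := by
  obtain ⟨W, hW⟩ := isCompact_Icc.exists_bound_of_continuousOn hw
  have hmeas : Measurable (Function.uncurry fun s τ => (Ioi s).indicator
      (fun τ => balayageKernel α ξ t τ * (τ - s) ^ (α - 1)) τ) := by
    have h1 : Measurable fun p : ℝ × ℝ => balayageKernel α ξ t p.2 * (p.2 - p.1) ^ (α - 1) :=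
      ((measurable_balayageKernel α ξ t).comp measurable_snd).mul (by fun_prop)
    exact h1.indicator (measurableSet_lt measurable_fst measurable_snd)
  have hker : Integrable (Function.uncurry fun s τ => (Ioi s).indicator
      (fun τ => balayageKernel α ξ t τ * (τ - s) ^ (α - 1)) τ)
      ((volume.restrict (Ioo 0 ξ)).prod (volume.restrict (Ioo 0 ξ))) := by
    rw [integrable_prod_iff hmeas.aestronglyMeasurable]
    constructor
    · filter_upwards [ae_restrict_mem measurableSet_Ioo] with s hs
      have := integrableOn_balayageKernel_mul_rpow hα hs.2 hξt
      change Integrable ((Ioi s).indicator _) _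
      rw [integrable_indicator_iff measurableSet_Ioi, IntegrableOn,
        Measure.restrict_restrict measurableSet_Ioi]
      exact this.mono_set fun τ hτ => ⟨hτ.1, hτ.2.2⟩
    · have hint : IntegrableOn (fun s => (t - s) ^ (α - 1)) (Ioo 0 ξ) :=
        (intervalIntegrable_sub_rpow hα.1 0 ξ).1.mono_set Ioo_subset_Ioc_self
      refine hint.congr_fun (fun s hs => ?_) measurableSet_Ioo
      simp only [← setIntegral_balayageKernel_mul_rpow hα hs.2 hξt]
      have hset : Ioo s ξ = Ioo 0 ξ ∩ Ioi s := by
        ext τ; exact ⟨fun h => ⟨⟨hs.1.trans h.1, h.2⟩, h.1⟩, fun h => ⟨h.2, h.1.2⟩⟩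
      rw [hset, ← setIntegral_indicator measurableSet_Ioi]
      refine setIntegral_congr_fun measurableSet_Ioo fun τ hτ => ?_
      refine (Real.norm_of_nonneg (indicator_apply_nonneg fun h => ?_)).symm
      exact mul_nonneg (balayageKernel_nonneg hα hξt hτ.2)
        (Real.rpow_nonneg (sub_nonneg.2 (le_of_lt h)) _)
  refine hker.bdd_mul (c := W) ?_ ?_
  · exact ((hw.mono Ioo_subset_Icc_self).aestronglyMeasurable measurableSet_Ioo).comp_fst
  · rw [Measure.prod_restrict]
    filter_upwards [ae_restrict_mem (measurableSet_Ioo.prod measurableSet_Ioo)] with p hp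
    exact hW _ (Ioo_subset_Icc_self hp.1)

theorem setIntegral_mul_indicator_balayage {α ξ t τ : ℝ} (w : ℝ → ℝ) (hτ : τ ∈ Ioo 0 ξ) :
    ∫ s in Ioo 0 ξ, w s * (Ioi s).indicator
        (fun τ => balayageKernel α ξ t τ * (τ - s) ^ (α - 1)) τ =
      balayageKernel α ξ t τ * ∫ s in (0 : ℝ)..τ, (τ - s) ^ (α - 1) * w s := by
  have hset : Ioo 0 τ = Ioo 0 ξ ∩ Iio τ := by
    ext s; exact ⟨fun h => ⟨⟨h.1, h.2.trans hτ.2⟩, h.2⟩, fun h => ⟨h.1.1, h.2⟩⟩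
  rw [intervalIntegral.integral_of_le hτ.1.le, integral_Ioc_eq_integral_Ioo,
    ← integral_const_mul, hset, ← setIntegral_indicator measurableSet_Iio]
  refine setIntegral_congr_fun measurableSet_Ioo fun s _ => ?_
  by_cases h : s < τ
  · simp [h]; ring
  · simp [h]

theorem integrableOn_balayageKernel_mul_integral {α ξ t : ℝ} (hα : α ∈ Ioo (0 : ℝ) 1)
    (hξt : ξ < t) {w : ℝ → ℝ} (hw : ContinuousOn w (Icc 0 ξ)) :
    IntegrableOn (fun τ => balayageKernel α ξ t τ * ∫ s in (0 : ℝ)..τ, (τ - s) ^ (α - 1) * w s)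
      (Ioo 0 ξ) :=
  IntegrableOn.congr_fun (integrable_balayage_prod hα hξt hw).integral_prod_right
    (fun _ hτ => setIntegral_mul_indicator_balayage w hτ) measurableSet_Ioo

/-- The balayage identity: values at `t` of a Riemann–Liouville potential of a density on `[0, ξ]`
are averages of its values on `[0, ξ]`. -/
theorem setIntegral_balayageKernel_mul_integral {α ξ t : ℝ} (hα : α ∈ Ioo (0 : ℝ) 1)
    (hξ : 0 ≤ ξ) (hξt : ξ < t) {w : ℝ → ℝ} (hw : ContinuousOn w (Icc 0 ξ)) :
    ∫ τ in Ioo 0 ξ, balayageKernel α ξ t τ * ∫ s in (0 : ℝ)..τ, (τ - s) ^ (α - 1) * w s =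
      ∫ s in (0 : ℝ)..ξ, (t - s) ^ (α - 1) * w s := by
  rw [← setIntegral_congr_fun measurableSet_Ioo
    (fun _ hτ => setIntegral_mul_indicator_balayage w hτ),
    ← integral_integral_swap (integrable_balayage_prod hα hξt hw),
    intervalIntegral.integral_of_le hξ, integral_Ioc_eq_integral_Ioo]
  refine setIntegral_congr_fun measurableSet_Ioo fun s hs => ?_
  have hset : Ioo 0 ξ ∩ Ioi s = Ioo s ξ := by
    ext τ; exact ⟨fun h => ⟨h.2, h.1.2⟩, fun h => ⟨⟨hs.1.trans h.1, h.2⟩, h.1⟩⟩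
  rw [integral_const_mul, setIntegral_indicator measurableSet_Ioi, hset,
    setIntegral_balayageKernel_mul_rpow hα hs.2 hξt, mul_comm]

theorem integrableOn_balayageKernel {α ξ t : ℝ} (hα : α ∈ Ioo (0 : ℝ) 1) (hξ : 0 < ξ)
    (hξt : ξ < t) : IntegrableOn (balayageKernel α ξ t) (Ioo 0 ξ) := by
  refine ((integrableOn_balayageKernel_mul_rpow hα hξ hξt).const_mul (ξ ^ (1 - α))).mono'
    (measurable_balayageKernel α ξ t).aestronglyMeasurable ?_
  filter_upwards [ae_restrict_mem measurableSet_Ioo] with τ hτ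
  have hP := balayageKernel_nonneg hα hξt hτ.2
  rw [Real.norm_of_nonneg hP, sub_zero]
  have h1 : 1 ≤ ξ ^ (1 - α) * τ ^ (α - 1) := by
    rw [← neg_sub 1 α, Real.rpow_neg hτ.1.le, ← div_eq_mul_inv,
      one_le_div (Real.rpow_pos_of_pos hτ.1 _)]
    exact Real.rpow_le_rpow hτ.1.le hτ.2.le (by linarith [hα.2])
  nlinarith [mul_le_mul_of_nonneg_left h1 hP]

theorem setIntegral_balayageKernel_le_one {α ξ t : ℝ} (hα : α ∈ Ioo (0 : ℝ) 1) (hξ : 0 < ξ)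
    (hξt : ξ < t) : ∫ τ in Ioo 0 ξ, balayageKernel α ξ t τ ≤ 1 := by
  have h := setIntegral_mono_on (f := fun τ => balayageKernel α ξ t τ * ξ ^ (α - 1))
    ((integrableOn_balayageKernel hα hξ hξt).mul_const _)
    (integrableOn_balayageKernel_mul_rpow hα hξ hξt) measurableSet_Ioo fun τ hτ =>
      mul_le_mul_of_nonneg_left (Real.rpow_le_rpow_of_nonpos (by linarith [hτ.1])
        (by linarith [hτ.2]) (by linarith [hα.2])) (balayageKernel_nonneg hα hξt hτ.2)
  rw [integral_mul_const, setIntegral_balayageKernel_mul_rpow hα hξ hξt, sub_zero] at h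
  have h2 : t ^ (α - 1) ≤ ξ ^ (α - 1) :=
    Real.rpow_le_rpow_of_nonpos hξ hξt.le (by linarith [hα.2])
  have hpos : 0 < ξ ^ (α - 1) := Real.rpow_pos_of_pos hξ _
  exact le_of_mul_le_mul_right (by linarith) hpos

/-- A strong maximum principle: a nonnegative `e = c + k * w` with `c ≥ 0`, where `k` is a
Riemann–Liouville kernel, cannot vanish at a point where `w` is positive. -/
theorem pos_of_fractional_integral {α t c : ℝ} (hα : α ∈ Ioo (0 : ℝ) 1) (ht : 0 < t) (hc : 0 ≤ c)
    {e w : ℝ → ℝ} (hw : ContinuousOn w (Icc 0 t))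
    (he : ∀ τ ∈ Icc 0 t, e τ = c + ∫ s in (0 : ℝ)..τ, (τ - s) ^ (α - 1) * w s)
    (hnn : ∀ τ ∈ Icc 0 t, 0 ≤ e τ) (hwt : 0 < w t) : 0 < e t := by
  have hev : ∀ᶠ s in nhdsWithin t (Icc 0 t), 0 < w s :=
    (hw t (right_mem_Icc.2 ht.le)).eventually (lt_mem_nhds hwt)
  obtain ⟨δ, hδ, hball⟩ := Metric.mem_nhdsWithin_iff.1 hev
  set ξ := max (t / 2) (t - δ / 2) with hξdef
  have hξ : 0 < ξ := lt_max_of_lt_left (by linarith)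
  have hξt : ξ < t := max_lt (by linarith) (by linarith)
  have hwpos : ∀ s ∈ Icc ξ t, 0 < w s := by
    intro s hs
    refine hball ⟨?_, hξ.le.trans hs.1, hs.2⟩
    have h1 : t - δ / 2 ≤ s := (le_max_right _ _).trans hs.1
    rw [Metric.mem_ball, Real.dist_eq, abs_lt]
    constructor <;> linarith [hs.2]
  have hint : ∀ a b, a ∈ Icc 0 t → b ∈ Icc 0 t →
      IntervalIntegrable (fun s => (t - s) ^ (α - 1) * w s) volume a b := fun a b ha hb =>
    (intervalIntegrable_sub_rpow hα.1 a b).mul_continuousOn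
      (hw.mono ((convex_Icc 0 t).ordConnected.uIcc_subset ha hb))
  have h0m : (0 : ℝ) ∈ Icc 0 t := left_mem_Icc.2 ht.le
  have htm : t ∈ Icc 0 t := right_mem_Icc.2 ht.le
  have hξm : ξ ∈ Icc 0 t := ⟨hξ.le, hξt.le⟩
  have htail : 0 < ∫ s in ξ..t, (t - s) ^ (α - 1) * w s := by
    refine intervalIntegral.intervalIntegral_pos_of_pos_on (hint ξ t hξm htm)
      (fun s hs => ?_) hξt
    exact mul_pos (Real.rpow_pos_of_pos (sub_pos.2 hs.2) _) (hwpos s ⟨hs.1.le, hs.2.le⟩)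
  have hw' := hw.mono (Icc_subset_Icc_right hξt.le)
  have hhead : -c ≤ ∫ s in (0 : ℝ)..ξ, (t - s) ^ (α - 1) * w s := by
    rw [← setIntegral_balayageKernel_mul_integral hα hξ.le hξt hw']
    have h := setIntegral_mono_on ((integrableOn_balayageKernel hα hξ hξt).mul_const (-c))
      (integrableOn_balayageKernel_mul_integral hα hξt hw') measurableSet_Ioo fun τ hτ => by
        have hτm : τ ∈ Icc 0 t := ⟨hτ.1.le, hτ.2.le.trans hξt.le⟩
        refine mul_le_mul_of_nonneg_left ?_ (balayageKernel_nonneg hα hξt hτ.2)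
        linarith [hnn τ hτm, he τ hτm]
    rw [integral_mul_const] at h
    nlinarith [setIntegral_balayageKernel_le_one hα hξ hξt]
  rw [he t htm, ← intervalIntegral.integral_add_adjacent_intervals (hint 0 ξ h0m hξm)
    (hint ξ t hξm htm)]
  linarith

/-- For every `M` there is a positive barrier `ψ = 1 + k * g` with `M ψ < g`. -/
theorem exists_fractional_barrier {α : ℝ} (hα : 0 < α) {M : ℝ} (hM : 0 ≤ M) :
    ∃ ψ g : ℝ → ℝ, Continuous g ∧ ContinuousOn ψ (Ici 0) ∧
      (∀ t, 0 ≤ t → 1 ≤ ψ t) ∧ (∀ t, 0 ≤ t → M * ψ t < g t) ∧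
      ∀ t, 0 ≤ t → ψ t = 1 + ∫ s in (0 : ℝ)..t, (t - s) ^ (α - 1) * g s := by
  have hΓ := Real.Gamma_pos_of_pos hα
  set N := 2 * (M + 1) * Real.Gamma α with hN
  have hNpos : 0 < N := by positivity
  set l := N ^ (1 / α) with hl
  have hlpos : 0 < l := Real.rpow_pos_of_pos hNpos _
  have hlα : l ^ α = N := by
    rw [hl, ← Real.rpow_mul hNpos.le, one_div_mul_cancel hα.ne', Real.rpow_one]
  have hint : IntegrableOn (fun u : ℝ => u ^ (α - 1) * Real.exp (-(l * u))) (Ioi 0) := by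
    simpa using integrableOn_rpow_mul_exp_neg_mul_rpow (p := 1) (s := α - 1) (by linarith)
      one_pos hlpos
  have hval : ∫ u in Ioi (0 : ℝ), u ^ (α - 1) * Real.exp (-(l * u)) = 1 / (2 * (M + 1)) := by
    rw [Real.integral_rpow_mul_exp_neg_mul_Ioi hα hlpos, Real.div_rpow one_pos.le hlpos.le,
      Real.one_rpow, hlα, hN]
    field_simp
  set L := 2 * M + 1 with hL
  let I : ℝ → ℝ := fun t => ∫ u in (0 : ℝ)..t, u ^ (α - 1) * Real.exp (-(l * u))
  have hnn : ∀ u ∈ Ioi (0 : ℝ), 0 ≤ u ^ (α - 1) * Real.exp (-(l * u)) := fun u hu =>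
    mul_nonneg (Real.rpow_nonneg (le_of_lt hu) _) (Real.exp_pos _).le
  have hI0 : ∀ t, 0 ≤ t → 0 ≤ I t := fun t ht => by
    simp only [I]
    rw [intervalIntegral.integral_of_le ht]
    exact setIntegral_nonneg measurableSet_Ioc fun u hu => hnn u hu.1
  have hI1 : ∀ t, 0 ≤ t → I t ≤ 1 / (2 * (M + 1)) := fun t ht => by
    simp only [I]
    rw [intervalIntegral.integral_of_le ht, ← hval]
    exact setIntegral_mono_set hint ((ae_restrict_iff' measurableSet_Ioi).2 (.of_forall hnn))
      (Ioc_subset_Ioi_self.eventuallyLE)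
  refine ⟨fun t => 1 + L * Real.exp (l * t) * I t, fun t => L * Real.exp (l * t),
    by fun_prop, ?_, ?_, ?_, ?_⟩
  · have hIc : Continuous I := by
      refine intervalIntegral.continuous_primitive (fun a b => ?_) 0
      exact (intervalIntegral.intervalIntegrable_rpow' (by linarith)).mul_continuousOn
        (by fun_prop)
    fun_prop
  · intro t ht
    have := hI0 t ht
    have : 0 ≤ L * Real.exp (l * t) * I t := by positivity
    linarith
  · intro t ht
    have h1 : 1 ≤ Real.exp (l * t) := Real.one_le_exp (by positivity)
    have h2 : M * I t ≤ 1 / 2 := by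
      calc M * I t ≤ M * (1 / (2 * (M + 1))) := mul_le_mul_of_nonneg_left (hI1 t ht) hM
        _ ≤ 1 / 2 := by rw [mul_one_div, div_le_div_iff₀ (by positivity) two_pos]; linarith
    have h3 : L * Real.exp (l * t) * (M * I t) ≤ L * Real.exp (l * t) * (1 / 2) :=
      mul_le_mul_of_nonneg_left h2 (by positivity)
    nlinarith
  · intro t ht
    have := intervalIntegral.integral_comp_sub_left (a := 0) (b := t)
      (fun u => u ^ (α - 1) * (L * Real.exp (l * (t - u)))) t
    simp only [sub_sub_cancel, sub_self, sub_zero] at this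
    rw [this]
    simp only [I]
    rw [← intervalIntegral.integral_const_mul]
    congr 1
    refine intervalIntegral.integral_congr fun u _ => ?_
    rw [show l * (t - u) = l * t + -(l * u) by ring, Real.exp_add]
    ring

/-- Positivity for fractional Volterra equations `d = c + k * f` with `c ≥ 0` and `f ≥ M d`
wherever `d < 0`. -/
theorem nonneg_of_fractional_integral {α T c M : ℝ} (hα : α ∈ Ioo (0 : ℝ) 1) (hM : 0 ≤ M)
    (hc : 0 ≤ c) {d f : ℝ → ℝ} (hd : ContinuousOn d (Icc 0 T)) (hf : ContinuousOn f (Icc 0 T))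
    (hdf : ∀ t ∈ Icc 0 T, d t = c + ∫ s in (0 : ℝ)..t, (t - s) ^ (α - 1) * f s)
    (hfd : ∀ t ∈ Icc 0 T, d t < 0 → M * d t ≤ f t) :
    ∀ t ∈ Icc 0 T, 0 ≤ d t := by
  obtain ⟨ψ, g, hg, hψc, hψ1, hψg, hψ⟩ := exists_fractional_barrier hα.1 hM
  have hψpos : ∀ t ∈ Icc 0 T, 0 < ψ t := fun t ht => one_pos.trans_le (hψ1 t ht.1)
  intro t₁ ht₁
  by_contra! hneg
  obtain ⟨t, ht, hmin⟩ := isCompact_Icc.exists_isMinOn ⟨t₁, ht₁⟩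
    (hd.div (hψc.mono fun _ h => h.1) fun t ht => (hψpos t ht).ne')
  set θ := -(d t / ψ t) with hθdef
  have hθ : 0 < θ := by
    have h1 : d t / ψ t ≤ d t₁ / ψ t₁ := hmin ht₁
    have h2 := div_neg_of_neg_of_pos hneg (hψpos t₁ ht₁)
    linarith
  have hdt : d t = -θ * ψ t := by
    rw [hθdef, neg_neg, div_mul_cancel₀ _ (hψpos t ht).ne']
  have hsub : Icc 0 t ⊆ Icc 0 T := Icc_subset_Icc_right ht.2
  have hdneg : d t < 0 := by rw [hdt]; nlinarith [hψpos t ht]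
  have ht0 : 0 < t := by
    refine ht.1.lt_of_ne fun h => ?_
    have := hdf t ht
    rw [← h, intervalIntegral.integral_same, h] at this
    linarith
  have key := pos_of_fractional_integral (e := fun τ => d τ + θ * ψ τ)
    (w := fun s => f s + θ * g s) (c := c + θ) hα ht0 (by linarith)
    ((hf.mono hsub).add (by fun_prop)) (fun τ hτ => ?_) (fun τ hτ => ?_) ?_
  · simp only [hdt] at key
    linarith
  · have hu : uIcc 0 τ ⊆ Icc 0 T := by
      rw [uIcc_of_le hτ.1]; exact Icc_subset_Icc_right (hτ.2.trans ht.2)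
    have i1 := (intervalIntegrable_sub_rpow (t := τ) hα.1 0 τ).mul_continuousOn (hf.mono hu)
    have i2 := (intervalIntegrable_sub_rpow (t := τ) hα.1 0 τ).mul_continuousOn hg.continuousOn
    have : ∀ s, (τ - s) ^ (α - 1) * (f s + θ * g s)
        = (τ - s) ^ (α - 1) * f s + θ * ((τ - s) ^ (α - 1) * g s) := fun s => by ring
    simp only [this]
    rw [intervalIntegral.integral_add i1 (i2.const_mul θ), intervalIntegral.integral_const_mul,
      hdf τ (hsub hτ), hψ τ hτ.1]
    ring
  · have h1 : d t / ψ t ≤ d τ / ψ τ := hmin (hsub hτ)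
    have h2 : -θ ≤ d τ / ψ τ := by linarith
    rw [le_div_iff₀ (hψpos τ (hsub hτ))] at h2
    linarith
  · have h1 := hfd t ht hdneg
    have h2 := mul_lt_mul_of_pos_left (hψg t ht.1) hθ
    rw [hdt] at h1
    linarith

/-- The comparison principle for a nonnegative initial value. -/
theorem fractional_comparison_of_nonneg
    {α T : ℝ} (hα : α ∈ Ioo (0 : ℝ) 1)
    {a₁ a₂ : ℝ → ℝ} (ha₁ : ContinuousOn a₁ (Icc 0 T)) (ha₂ : ContinuousOn a₂ (Icc 0 T))
    (hle : ∀ t ∈ Icc (0 : ℝ) T, a₁ t ≤ a₂ t)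
    {x₀ : ℝ} (hx₀ : 0 ≤ x₀)
    {x₁ x₂ : ℝ → ℝ} (hx₁c : ContinuousOn x₁ (Icc 0 T)) (hx₂c : ContinuousOn x₂ (Icc 0 T))
    (hx₁ : ∀ t ∈ Icc (0 : ℝ) T,
      x₁ t = x₀ + (1 / Real.Gamma α) * ∫ s in (0 : ℝ)..t, (t - s) ^ (α - 1) * (a₁ s * x₁ s))
    (hx₂ : ∀ t ∈ Icc (0 : ℝ) T,
      x₂ t = x₀ + (1 / Real.Gamma α) * ∫ s in (0 : ℝ)..t, (t - s) ^ (α - 1) * (a₂ s * x₂ s)) :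
    ∀ t ∈ Icc (0 : ℝ) T, 0 ≤ x₁ t ∧ x₁ t ≤ x₂ t := by
  have hγ : 0 < 1 / Real.Gamma α := one_div_pos.2 (Real.Gamma_pos_of_pos hα.1)
  set γ := 1 / Real.Gamma α
  obtain ⟨A, hA⟩ := isCompact_Icc.exists_bound_of_continuousOn ha₂
  have hA' : ∀ t ∈ Icc 0 T, a₂ t ≤ |A| := fun t ht =>
    (le_abs_self _).trans ((hA t ht).trans (le_abs_self A))
  have hM : 0 ≤ γ * |A| := by positivity
  have e₁ : ∀ t ∈ Icc 0 T,
      x₁ t = x₀ + ∫ s in (0 : ℝ)..t, (t - s) ^ (α - 1) * (γ * (a₁ s * x₁ s)) := fun t ht => by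
    rw [hx₁ t ht, ← intervalIntegral.integral_const_mul]
    simp only [mul_left_comm]
  have e₂ : ∀ t ∈ Icc 0 T,
      x₂ t = x₀ + ∫ s in (0 : ℝ)..t, (t - s) ^ (α - 1) * (γ * (a₂ s * x₂ s)) := fun t ht => by
    rw [hx₂ t ht, ← intervalIntegral.integral_const_mul]
    simp only [mul_left_comm]
  have c₁ : ContinuousOn (fun s => γ * (a₁ s * x₁ s)) (Icc 0 T) := by fun_prop
  have c₂ : ContinuousOn (fun s => γ * (a₂ s * x₂ s)) (Icc 0 T) := by fun_prop
  have pos₁ : ∀ t ∈ Icc 0 T, 0 ≤ x₁ t := by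
    refine nonneg_of_fractional_integral hα hM hx₀ hx₁c c₁ e₁ fun t ht hneg => ?_
    rw [mul_assoc]
    exact mul_le_mul_of_nonneg_left
      (mul_le_mul_of_nonpos_right ((hle t ht).trans (hA' t ht)) hneg.le) hγ.le
  have hdiff : ∀ t ∈ Icc 0 T, 0 ≤ x₂ t - x₁ t := by
    refine nonneg_of_fractional_integral (c := 0) (d := fun t => x₂ t - x₁ t)
      (f := fun s => γ * (a₂ s * x₂ s) - γ * (a₁ s * x₁ s)) hα hM le_rfl
      (hx₂c.sub hx₁c) (c₂.sub c₁) (fun t ht => ?_) fun t ht hneg => ?_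
    · have hu : uIcc 0 t ⊆ Icc 0 T := by
        rw [uIcc_of_le ht.1]; exact Icc_subset_Icc_right ht.2
      have hk := intervalIntegrable_sub_rpow (t := t) hα.1 0 t
      simp only [mul_sub]
      rw [intervalIntegral.integral_sub (hk.mul_continuousOn (c₂.mono hu))
        (hk.mul_continuousOn (c₁.mono hu)), e₁ t ht, e₂ t ht]
      ring
    · have h1 : |A| * (x₂ t - x₁ t) ≤ a₂ t * (x₂ t - x₁ t) :=
        mul_le_mul_of_nonpos_right (hA' t ht) hneg.le
      have h2 : 0 ≤ (a₂ t - a₁ t) * x₁ t := mul_nonneg (sub_nonneg.2 (hle t ht)) (pos₁ t ht)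
      rw [mul_assoc, ← mul_sub]
      exact mul_le_mul_of_nonneg_left (by linarith) hγ.le
  exact fun t ht => ⟨pos₁ t ht, sub_nonneg.1 (hdiff t ht)⟩

/-- comparison principle `|x₁(t)| ≤ |x₂(t)|` for solutions of the scalar
fractional Volterra equations with coefficients `a₁ ≤ a₂` and the same initial value. -/
theorem scalar_caputo_comparison
    (α T : ℝ) (hα : α ∈ Set.Ioo (0:ℝ) 1) (hT : 0 < T)
    (a₁ a₂ : ℝ → ℝ) (ha₁ : ContinuousOn a₁ (Set.Icc 0 T)) (ha₂ : ContinuousOn a₂ (Set.Icc 0 T))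
    (hle : ∀ t ∈ Set.Icc (0:ℝ) T, a₁ t ≤ a₂ t)
    (x₀ : ℝ)
    (x₁ x₂ : ℝ → ℝ) (hx₁c : ContinuousOn x₁ (Set.Icc 0 T)) (hx₂c : ContinuousOn x₂ (Set.Icc 0 T))
    (hx₁ : ∀ t ∈ Set.Icc (0:ℝ) T,
      x₁ t = x₀ + (1 / Real.Gamma α) * ∫ s in (0:ℝ)..t, (t - s) ^ (α - 1) * (a₁ s * x₁ s))
    (hx₂ : ∀ t ∈ Set.Icc (0:ℝ) T,
      x₂ t = x₀ + (1 / Real.Gamma α) * ∫ s in (0:ℝ)..t, (t - s) ^ (α - 1) * (a₂ s * x₂ s)) :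
    ∀ t ∈ Set.Icc (0:ℝ) T, |x₁ t| ≤ |x₂ t| := by
  intro t ht
  rcases le_total 0 x₀ with h0 | h0
  · obtain ⟨h1, h2⟩ :=
      fractional_comparison_of_nonneg hα ha₁ ha₂ hle h0 hx₁c hx₂c hx₁ hx₂ t ht
    rwa [abs_of_nonneg h1, abs_of_nonneg (h1.trans h2)]
  · obtain ⟨h1, h2⟩ := fractional_comparison_of_nonneg (x₀ := -x₀) (x₁ := fun s => -x₁ s)
      (x₂ := fun s => -x₂ s) hα ha₁ ha₂ hle (neg_nonneg.2 h0) hx₁c.neg hx₂c.neg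
      (fun t ht => by
        simp only [mul_neg, intervalIntegral.integral_neg]
        linarith [hx₁ t ht])
      (fun t ht => by
        simp only [mul_neg, intervalIntegral.integral_neg]
        linarith [hx₂ t ht]) t ht
    rw [← abs_neg (x₁ t), ← abs_neg (x₂ t), abs_of_nonneg h1, abs_of_nonneg (h1.trans h2)]
    exact h2
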